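/- Let L and G be c-utility act sets on K. If the function p ↦ max(0, h_G(p) − h_L(p)) is convex on Δ(K) (equivalently, if the union L ⊕ G = closure(convexHull ℝ (L ∪ G)) values information more than L), then: (a) the set {p ∈ Δ(K) : h_G(p) ≤ h_L(p)} is convex; (b) for every g ∈ G there exists l ∈ L such that {p ∈ Δ(K) : h_L(p) ≤ ⟨p, g⟩ and h_G(p) = ⟨p, g⟩} ⊆ {p ∈ Δ(K) : h_L(p) = ⟨p, l⟩}. -/

import Mathlib

open MeasureTheory Pointwise

/-- The pairing `⟨p, x⟩ = ∑ k, p k * x k`. -/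
def pairing {K : Type} [Fintype K] (p x : K → ℝ) : ℝ := ∑ k, p k * x k

/-- The simplex of beliefs `Δ(K)`. -/
def simplexSet (K : Type) [Fintype K] : Set (K → ℝ) :=
  {p | (∀ k, 0 ≤ p k) ∧ ∑ k, p k = 1}

/-- The negative orthant `ℝ₋^K`. -/
def negOrthant (K : Type) [Fintype K] : Set (K → ℝ) := {v | ∀ k, v k ≤ 0}

/-- The restricted support function `h_G`. -/
noncomputable def suppFn {K : Type} [Fintype K] (G : Set (K → ℝ)) (p : K → ℝ) : ℝ :=
  sSup ((fun g => pairing p g) '' G)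

/-- A c-utility act set: nonempty, closed, convex, comprehensive, with
`{⟨p, g⟩ : g ∈ G}` bounded above for each belief `p`, and `h_G` continuous on the simplex. -/
def IsCUAS {K : Type} [Fintype K] (G : Set (K → ℝ)) : Prop :=
  G.Nonempty ∧ IsClosed G ∧ Convex ℝ G ∧
  (∀ g ∈ G, ∀ v ∈ negOrthant K, g + v ∈ G) ∧
  (∀ p ∈ simplexSet K, BddAbove ((fun g => pairing p g) '' G)) ∧
  ContinuousOn (suppFn G) (simplexSet K)

/-- The value of information of information structure `q` for decision maker `G`. -/
noncomputable def VoI {K : Type} [Fintype K] (G : Set (K → ℝ)) {Ω : Type}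
    [MeasurableSpace Ω] (ℙ : Measure Ω) (q : Ω → K → ℝ) : ℝ :=
  (∫ ω, suppFn G (q ω) ∂ℙ) - suppFn G (∫ ω, q ω ∂ℙ)

theorem pairing_add_left {K : Type} [Fintype K] (p q x : K → ℝ) :
    pairing (p + q) x = pairing p x + pairing q x :=
  add_dotProduct p q x

theorem pairing_smul_left {K : Type} [Fintype K] (c : ℝ) (p x : K → ℝ) :
    pairing (c • p) x = c * pairing p x :=
  smul_dotProduct c p x

theorem pairing_comm {K : Type} [Fintype K] (p x : K → ℝ) : pairing p x = pairing x p :=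
  dotProduct_comm p x

theorem exists_forall_eq_pairing {K : Type} [Fintype K] (φ : (K → ℝ) →ₗ[ℝ] ℝ) :
    ∃ a : K → ℝ, ∀ x, φ x = pairing x a := by
  classical
  exact ⟨_, fun x => LinearMap.pi_apply_eq_sum_univ φ x⟩

theorem convex_simplexSet (K : Type) [Fintype K] : Convex ℝ (simplexSet K) :=
  convex_stdSimplex ℝ K

theorem pairing_le_suppFn {K : Type} [Fintype K] {L : Set (K → ℝ)} {p l : K → ℝ}
    (h : BddAbove ((fun g => pairing p g) '' L)) (hl : l ∈ L) : pairing p l ≤ suppFn L p :=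
  le_csSup h (Set.mem_image_of_mem _ hl)

theorem suppFn_le {K : Type} [Fintype K] {L : Set (K → ℝ)} (hL : L.Nonempty) {p : K → ℝ} {c : ℝ}
    (h : ∀ l ∈ L, pairing p l ≤ c) : suppFn L p ≤ c :=
  csSup_le (hL.image _) (by rintro _ ⟨l, hl, rfl⟩; exact h l hl)

theorem bddAbove_pairing_of_pos {K : Type} [Fintype K] [Nonempty K] {L : Set (K → ℝ)}
    (hL : ∀ p ∈ simplexSet K, BddAbove ((fun g => pairing p g) '' L)) {x : K → ℝ}
    (hx : ∀ k, 0 < x k) : BddAbove ((fun g => pairing x g) '' L) := by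
  have hs : 0 < ∑ k, x k := Finset.sum_pos (fun k _ => hx k) Finset.univ_nonempty
  set s := ∑ k, x k
  have hp : s⁻¹ • x ∈ simplexSet K := by
    refine ⟨fun k => mul_nonneg (inv_nonneg.2 hs.le) (hx k).le, ?_⟩
    simp only [Pi.smul_apply, smul_eq_mul, ← Finset.mul_sum]
    exact inv_mul_cancel₀ hs.ne'
  obtain ⟨b, hb⟩ := hL _ hp
  refine ⟨s * b, ?_⟩
  rintro _ ⟨l, hl, rfl⟩
  have h := hb ⟨l, hl, rfl⟩
  simp only [pairing_smul_left] at h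
  exact (inv_mul_le_iff₀ hs).1 h

theorem isOpen_pos (K : Type) [Fintype K] : IsOpen {x : K → ℝ | ∀ k, 0 < x k} := by
  simp only [Set.ofPred_forall]
  exact isOpen_iInter_of_finite fun k => isOpen_lt continuous_const (continuous_apply k)

theorem convex_pos (K : Type) : Convex ℝ {x : K → ℝ | ∀ k, 0 < x k} := by
  intro x hx y hy a b ha hb hab k
  exact convex_Ioi (0 : ℝ) (hx k) (hy k) ha hb hab

theorem convexOn_suppFn_pos {K : Type} [Fintype K] [Nonempty K] {L : Set (K → ℝ)}
    (hne : L.Nonempty) (hL : ∀ p ∈ simplexSet K, BddAbove ((fun g => pairing p g) '' L)) :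
    ConvexOn ℝ {x : K → ℝ | ∀ k, 0 < x k} (suppFn L) := by
  refine ⟨convex_pos K, fun x hx y hy a b ha hb _ => suppFn_le hne fun l hl => ?_⟩
  rw [pairing_add_left, pairing_smul_left, pairing_smul_left]
  exact add_le_add
    (mul_le_mul_of_nonneg_left (pairing_le_suppFn (bddAbove_pairing_of_pos hL hx) hl) ha)
    (mul_le_mul_of_nonneg_left (pairing_le_suppFn (bddAbove_pairing_of_pos hL hy) hl) hb)

/-- A vector whose pairing with every positive vector is dominated by the support function of a
closed convex comprehensive set belongs to that set. -/
theorem mem_of_forall_pos_pairing_le_suppFn {K : Type} [Fintype K] [Nonempty K]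
    {L : Set (K → ℝ)} (hne : L.Nonempty) (hcl : IsClosed L) (hconv : Convex ℝ L)
    (hcomp : ∀ g ∈ L, ∀ v ∈ negOrthant K, g + v ∈ L)
    (hbdd : ∀ p ∈ simplexSet K, BddAbove ((fun g => pairing p g) '' L)) {l : K → ℝ}
    (hl : ∀ x : K → ℝ, (∀ k, 0 < x k) → pairing x l ≤ suppFn L x) : l ∈ L := by
  classical
  by_contra hlL
  obtain ⟨φ, u, hφL, hφl⟩ := geometric_hahn_banach_closed_point hconv hcl hlL
  obtain ⟨q, hq⟩ := exists_forall_eq_pairing φ.toLinearMap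
  have hq' : ∀ x, φ x = pairing q x := fun x => (hq x).trans (pairing_comm x q)
  have hq0 : ∀ k, 0 ≤ q k := by
    intro k
    by_contra! hk
    obtain ⟨g, hg⟩ := hne
    have hgu := hφL g hg
    set t := (u - φ g) / (-q k)
    have ht0 : 0 ≤ t := div_nonneg (by linarith) (by linarith)
    have h := hφL _ (hcomp g hg (Pi.single k (-t)) fun j => by
      by_cases hj : j = k
      · subst hj; simpa using ht0
      · simp [hj])
    have hs : φ (Pi.single k (-t)) = q k * (-t) := by
      rw [hq']
      exact dotProduct_single q (-t) k
    have htq : t * (-q k) = u - φ g := div_mul_cancel₀ _ (by linarith)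
    rw [map_add, hs] at h
    linarith
  set M := suppFn L 1
  have hb1 := bddAbove_pairing_of_pos hbdd (x := 1) fun _ => one_pos
  have key : ∀ ε > 0, φ l + ε * pairing 1 l ≤ u + ε * M := by
    intro ε hε
    have hx := hl (q + ε • 1) fun k => by
      have := hq0 k
      simp only [Pi.add_apply, Pi.smul_apply, Pi.one_apply, smul_eq_mul, mul_one]
      linarith
    have hle : suppFn L (q + ε • 1) ≤ u + ε * M := by
      refine suppFn_le hne fun g hg => ?_
      rw [pairing_add_left, pairing_smul_left, ← hq']
      exact add_le_add (hφL g hg).le (mul_le_mul_of_nonneg_left (pairing_le_suppFn hb1 hg) hε.le)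
    rw [pairing_add_left, pairing_smul_left, ← hq'] at hx
    exact hx.trans hle
  have hD : 0 < |M - pairing 1 l| + 1 := by positivity
  have h := key ((φ l - u) / (|M - pairing 1 l| + 1)) (div_pos (by linarith) hD)
  have hε : (φ l - u) / (|M - pairing 1 l| + 1) * (|M - pairing 1 l| + 1) = φ l - u :=
    div_mul_cancel₀ _ hD.ne'
  have hε0 : 0 < (φ l - u) / (|M - pairing 1 l| + 1) := div_pos (by linarith) hD
  nlinarith [le_abs_self (M - pairing 1 l)]

/-- Sandwich theorem: a concave function on the simplex lying below the support function of `L`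
at positive beliefs is dominated by the payoff of a single element of `L`. -/
theorem exists_mem_forall_le_pairing {K : Type} [Fintype K] [Nonempty K]
    {L : Set (K → ℝ)} (hL : IsCUAS L) {κ : (K → ℝ) → ℝ} (hκ : ConcaveOn ℝ (simplexSet K) κ)
    (hκL : ∀ p ∈ simplexSet K, κ p ≤ suppFn L p) :
    ∃ l ∈ L, ∀ p ∈ simplexSet K, κ p ≤ pairing p l := by
  obtain ⟨hne, hcl, hconv, hcomp, hbdd, -⟩ := hL
  have hΦ := convexOn_suppFn_pos hne hbdd
  have hopen : IsOpen {z : (K → ℝ) × ℝ | z.1 ∈ {x : K → ℝ | ∀ k, 0 < x k} ∧ suppFn L z.1 < z.2} := by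
    have hc : ContinuousOn (fun z : (K → ℝ) × ℝ => z.2 - suppFn L z.1)
        (Prod.fst ⁻¹' {x : K → ℝ | ∀ k, 0 < x k}) :=
      continuousOn_snd.sub ((hΦ.continuousOn (isOpen_pos K)).comp continuousOn_fst fun _ h => h)
    have := hc.isOpen_inter_preimage ((isOpen_pos K).preimage continuous_fst) (isOpen_Ioi (a := 0))
    convert this using 1
    ext z
    simp
  obtain ⟨φ, s, hA, hB⟩ := geometric_hahn_banach_open hΦ.convex_strict_epigraph hopen
    hκ.convex_hypograph (by
      rw [Set.disjoint_left]
      rintro z ⟨-, h1⟩ ⟨h2, h3⟩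
      exact absurd (h1.trans_le h3) (hκL _ h2).not_gt)
  obtain ⟨a, ha⟩ := exists_forall_eq_pairing (φ.toLinearMap ∘ₗ LinearMap.inl ℝ (K → ℝ) ℝ)
  set β := φ (0, 1)
  have hφ : ∀ x t, φ (x, t) = pairing x a + β * t := by
    intro x t
    have h1 : ((x, t) : (K → ℝ) × ℝ) = (x, 0) + t • (0, 1) := by simp
    have h2 : φ (x, 0) = pairing x a := ha x
    rw [h1, map_add, map_smul, h2, smul_eq_mul, mul_comm]
  have hA' : ∀ x : K → ℝ, (∀ k, 0 < x k) → ∀ t, suppFn L x < t → pairing x a + β * t < s :=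
    fun x hx t ht => hφ x t ▸ hA (x, t) ⟨hx, ht⟩
  have hB' : ∀ p ∈ simplexSet K, s ≤ pairing p a + β * κ p :=
    fun p hp => hφ p (κ p) ▸ hB (p, κ p) ⟨hp, le_rfl⟩
  have hβ : β < 0 := by
    have hc : (0 : ℝ) < Fintype.card K := by exact_mod_cast Fintype.card_pos
    have hu : (fun _ => (Fintype.card K : ℝ)⁻¹) ∈ simplexSet K :=
      ⟨fun _ => (inv_pos.2 hc).le, by simp⟩
    have h1 := hA' (fun _ => (Fintype.card K : ℝ)⁻¹) (fun _ => inv_pos.2 hc) _ (lt_add_one _)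
    have h2 := hB' _ hu
    have h3 := hκL _ hu
    by_contra! h
    nlinarith
  have hsupp : ∀ c > 0, ∀ x : K → ℝ, (∀ k, 0 < x k) → c * (pairing x a + β * suppFn L x) ≤ s := by
    intro c hc x hx
    have hcx : ∀ k, 0 < (c • x) k := fun k => mul_pos hc (hx k)
    have hle : suppFn L (c • x) ≤ c * suppFn L x := suppFn_le hne fun l hl => by
      rw [pairing_smul_left]
      exact mul_le_mul_of_nonneg_left (pairing_le_suppFn (bddAbove_pairing_of_pos hbdd hx) hl) hc.le
    refine le_of_forall_pos_lt_add fun ε hε => ?_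
    have h := hA' _ hcx (c * suppFn L x + ε / (-β))
      (hle.trans_lt (lt_add_of_pos_right _ (div_pos hε (by linarith))))
    have hε' : β * (ε / (-β)) = -ε := by
      rw [div_neg, mul_neg, mul_div_cancel₀ _ hβ.ne]
    rw [pairing_smul_left, mul_add, hε'] at h
    linarith
  have hnonpos : ∀ x : K → ℝ, (∀ k, 0 < x k) → pairing x a + β * suppFn L x ≤ 0 := by
    intro x hx
    by_contra! h
    have h1 := hsupp ((|s| + 1) / (pairing x a + β * suppFn L x)) (by positivity) x hx
    rw [div_mul_cancel₀ _ h.ne'] at h1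
    linarith [le_abs_self s]
  have hs : 0 ≤ s := by
    refine le_of_forall_pos_lt_add fun ε hε => ?_
    set w := pairing 1 a + β * suppFn L 1
    have hw : 0 < |w| + 1 := by positivity
    have h1 := hsupp (ε / (|w| + 1)) (by positivity) 1 fun _ => one_pos
    have h2 : ε / (|w| + 1) * (|w| + 1) = ε := div_mul_cancel₀ _ hw.ne'
    have h3 : 0 < ε / (|w| + 1) := by positivity
    have h4 : -|w| ≤ w := neg_abs_le w
    nlinarith
  have hdiv : ∀ x, pairing x ((-β)⁻¹ • a) = (-β)⁻¹ * pairing x a := fun x => by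
    rw [pairing_comm, pairing_smul_left, pairing_comm]
  refine ⟨(-β)⁻¹ • a, mem_of_forall_pos_pairing_le_suppFn hne hcl hconv hcomp hbdd
    fun x hx => ?_, fun p hp => ?_⟩
  · rw [hdiv, inv_mul_le_iff₀ (by linarith)]
    linarith [hnonpos x hx]
  · rw [hdiv, le_inv_mul_iff₀ (by linarith)]
    linarith [hB' p hp]

theorem concaveOn_pairing_left {K : Type} [Fintype K] (g : K → ℝ) :
    ConcaveOn ℝ (simplexSet K) (fun p => pairing p g) :=
  ⟨convex_simplexSet K, fun x _ y _ a b _ _ _ => by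
    simp only [pairing_add_left, pairing_smul_left, smul_eq_mul, le_refl]⟩

theorem union_values_information_more_necessary_conditions
    {K : Type} [Fintype K] [Nonempty K] (L G : Set (K → ℝ))
    (hL : IsCUAS L) (hG : IsCUAS G)
    (hcvx : ConvexOn ℝ (simplexSet K) (fun p => max 0 (suppFn G p - suppFn L p))) :
    Convex ℝ {p ∈ simplexSet K | suppFn G p ≤ suppFn L p} ∧
    ∀ g ∈ G, ∃ l ∈ L,
      {p ∈ simplexSet K | suppFn L p ≤ pairing p g ∧ suppFn G p = pairing p g}
        ⊆ {p ∈ simplexSet K | suppFn L p = pairing p l} := by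
  constructor
  · have h := hcvx.convex_le 0
    simpa only [max_le_iff, le_refl, true_and, sub_nonpos] using h
  · intro g hg
    obtain ⟨l, hl, hle⟩ := exists_mem_forall_le_pairing hL
      ((concaveOn_pairing_left g).sub hcvx) fun p hp => by
        have h1 := pairing_le_suppFn (hG.2.2.2.2.1 p hp) hg
        have h2 := le_max_right 0 (suppFn G p - suppFn L p)
        simp only [Pi.sub_apply]
        linarith
    refine ⟨l, hl, ?_⟩
    rintro p ⟨hp, hLg, hGg⟩
    refine ⟨hp, le_antisymm ?_ (pairing_le_suppFn (hL.2.2.2.2.1 p hp) hl)⟩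
    have h := hle p hp
    simp only [Pi.sub_apply] at h
    rw [hGg, max_eq_right (sub_nonneg.2 hLg)] at h
    linarith
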